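/- arXiv:1311.3257 — 8 statements merged into one kernel-verified Lean document; each statement's English description precedes it below -/
import Mathlib

section
/- Let p ≥ 2 and F ≥ 1 be integers. For each f ∈ {1,…,F}, let S⁽ᶠ⁾ ∈ ℂ^{p×p} be Hermitian positive definite, let T⁽ᶠ⁾ be its (unique) positive semidefinite square root, let y⁽ᶠ⁾ ∈ ℂ^p be the first column of T⁽ᶠ⁾, let X⁽ᶠ⁾ ∈ ℂ^{p×(p−1)} consist of the remaining p−1 columns of T⁽ᶠ⁾, and set β⁽ᶠ⁾ := ((X⁽ᶠ⁾)ᴴ X⁽ᶠ⁾)⁻¹ (X⁽ᶠ⁾)ᴴ y⁽ᶠ⁾ ∈ ℂ^{p−1}. Then for every k ∈ {2,…,p}: there exists f ∈ {1,…,F} with [(S⁽ᶠ⁾)⁻¹]_{k,1} ≠ 0 if and only if there exists f ∈ {1,…,F} with β⁽ᶠ⁾_{k−1} ≠ 0. (This is Proposition 1 of the paper: the union over f of the supports of the β⁽ᶠ⁾ equals the union over f of the supports of the first columns of the (S⁽ᶠ⁾)⁻¹, which determines the neighborhood of node 1 in the conditional independence graph.) -/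
open Matrix
open scoped ComplexOrder

/-- The off-diagonal part of the first column of the inverse of a positive definite matrix is,
up to the factor `-(S⁻¹)₀₀`, the solution of the normal equations. -/
lemma Matrix.PosDef.inv_succ_zero {n : ℕ} {S : Matrix (Fin (n + 1)) (Fin (n + 1)) ℂ}
    (hS : S.PosDef) (j : Fin n) :
    S⁻¹ j.succ 0 =
      -(S⁻¹ 0 0 * ((S.submatrix Fin.succ Fin.succ)⁻¹ *ᵥ fun i => S i.succ 0) j) := by
  have hA : (S.submatrix Fin.succ Fin.succ).PosDef := hS.submatrix (Fin.succ_injective n)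
  have hSS : S * S⁻¹ = 1 := mul_nonsing_inv S ((isUnit_iff_isUnit_det S).1 hS.isUnit)
  have hAA : (S.submatrix Fin.succ Fin.succ)⁻¹ * S.submatrix Fin.succ Fin.succ = 1 :=
    nonsing_inv_mul _ ((isUnit_iff_isUnit_det _).1 hA.isUnit)
  have key : S.submatrix Fin.succ Fin.succ *ᵥ (fun i => S⁻¹ i.succ 0) =
      (-S⁻¹ 0 0) • fun i => S i.succ 0 := by
    ext i
    have h := congrFun (congrFun hSS i.succ) 0
    rw [mul_apply, Fin.sum_univ_succ, one_apply_ne (Fin.succ_ne_zero i)] at h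
    simp only [mulVec, dotProduct, submatrix_apply, Pi.smul_apply, smul_eq_mul]
    linear_combination h
  have h := congrArg (fun u => ((S.submatrix Fin.succ Fin.succ)⁻¹ *ᵥ u) j) key
  simpa only [mulVec_mulVec, hAA, one_mulVec, mulVec_smul, Pi.smul_apply, smul_eq_mul,
    neg_mul] using h

/-- **Proposition 1 of the paper.** Let `p ≥ 2`, `F ≥ 1`.  For each `f`, let
`S⁽ᶠ⁾ ∈ ℂ^{p×p}` be Hermitian positive definite, `T⁽ᶠ⁾` its positive semidefinite square root,
`y⁽ᶠ⁾` the first column of `T⁽ᶠ⁾`, `X⁽ᶠ⁾` the remaining `p−1` columns, and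
`β⁽ᶠ⁾ := ((X⁽ᶠ⁾)ᴴX⁽ᶠ⁾)⁻¹(X⁽ᶠ⁾)ᴴy⁽ᶠ⁾`.  Then for every `k ∈ {2,…,p}` (`0`-indexed: `1 ≤ k`):
`(∃ f, [(S⁽ᶠ⁾)⁻¹]_{k,1} ≠ 0) ↔ (∃ f, β⁽ᶠ⁾_{k−1} ≠ 0)`. -/
theorem stmt0 (p F : ℕ) (hp : 2 ≤ p) (hF : 1 ≤ F)
    (S T : Fin F → Matrix (Fin p) (Fin p) ℂ)
    (hS : ∀ f, (S f).PosDef)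
    (hT : ∀ f, (T f).PosSemidef)
    (hTS : ∀ f, T f * T f = S f)
    (y : Fin F → Fin p → ℂ)
    (hy : ∀ f i, y f i = T f i ⟨0, by omega⟩)
    (X : Fin F → Matrix (Fin p) (Fin (p - 1)) ℂ)
    (hX : ∀ f i (j : Fin (p - 1)), X f i j = T f i ⟨j.1 + 1, by have := j.2; omega⟩)
    (β : Fin F → Fin (p - 1) → ℂ)
    (hβ : ∀ f, β f = ((X f)ᴴ * X f)⁻¹ *ᵥ ((X f)ᴴ *ᵥ y f)) :
    ∀ k : Fin p, ∀ hk : 1 ≤ k.1,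
      ((∃ f, (S f)⁻¹ k ⟨0, by omega⟩ ≠ 0) ↔
        (∃ f, β f ⟨k.1 - 1, by have := k.2; omega⟩ ≠ 0)) := by
  intro k hk
  obtain ⟨n, rfl⟩ : ∃ n, p = n + 1 := ⟨p - 1, by omega⟩
  refine exists_congr fun f => ?_
  obtain ⟨j, rfl⟩ := Fin.exists_succ_eq.2 (show k ≠ 0 by rintro rfl; simp at hk)
  have hST : ∀ a b, S f a b = ∑ i, star (T f i a) * T f i b := by
    intro a b
    rw [← hTS f, mul_apply]
    exact Finset.sum_congr rfl fun i _ => by rw [(hT f).isHermitian.apply]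
  have hA : (X f)ᴴ * X f = (S f).submatrix Fin.succ Fin.succ := by
    ext a b
    simp only [mul_apply, conjTranspose_apply, hX, submatrix_apply, hST]
    rfl
  have hb : (X f)ᴴ *ᵥ y f = fun i => S f i.succ 0 := by
    ext a
    simp only [mulVec, dotProduct, conjTranspose_apply, hX, hy, hST]
    rfl
  have hinv := (hS f).inv_succ_zero j
  have h0 : (S f)⁻¹ 0 0 ≠ 0 := (hS f).inv.diag_pos.ne'
  have hβj : β f j = (((S f).submatrix Fin.succ Fin.succ)⁻¹ *ᵥ fun i => S f i.succ 0) j := by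
    rw [hβ, hA, hb]
    rfl
  change (S f)⁻¹ j.succ 0 ≠ 0 ↔ β f j ≠ 0
  rw [hinv, ← hβj, neg_ne_zero, mul_ne_zero_iff]
  exact and_iff_right h0
end

section
/- Let p ≥ 1, let 0 < A ≤ B be real numbers, and let Σ : ℝ → ℂ^{p×p} be a continuous 1-periodic matrix-valued function such that for every θ ∈ ℝ the matrix Σ(θ) is Hermitian and satisfies A‖x‖² ≤ Re(xᴴ Σ(θ) x) ≤ B‖x‖² for all x ∈ ℂ^p (so Σ(θ) is positive definite and invertible). Fix indices k, l ∈ {1,…,p} and suppose the function θ ↦ [Σ(θ)⁻¹]_{k,l} is Lipschitz with constant L ≥ 0. Define the global partial coherence Γ := ∫₀¹ |[Σ(θ)⁻¹]_{k,l}| / √(Re([Σ(θ)⁻¹]_{k,k}) · Re([Σ(θ)⁻¹]_{l,l})) dθ. If F ≥ 1 is an integer with Γ > B·L/(4F), then there exists f ∈ {0,…,F−1} such that [Σ(f/F)⁻¹]_{k,l} ≠ 0. (This is a precise form of Lemma 1 of the paper: if the global partial coherence of an edge is large enough relative to the spectral smoothness, then the edge is visible at one of the F uniformly spaced sample frequencies.)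 -/
open Matrix

/-- A matrix whose quadratic form has real part bounded below by a positive multiple of the
squared Euclidean norm is invertible. -/
lemma isUnit_det_of_coercive {n : Type*} [Fintype n] [DecidableEq n] {M : Matrix n n ℂ} {A : ℝ}
    (hA : 0 < A) (h : ∀ x : n → ℂ, A * ∑ i, ‖x i‖ ^ 2 ≤ (star x ⬝ᵥ M *ᵥ x).re) :
    IsUnit M.det := by
  rw [isUnit_iff_ne_zero]
  intro h0
  obtain ⟨v, hv, hMv⟩ := Matrix.exists_mulVec_eq_zero_iff.mpr h0
  have h1 := h v
  rw [hMv, dotProduct_zero, Complex.zero_re] at h1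
  have hnn : ∀ i ∈ Finset.univ, 0 ≤ ‖v i‖ ^ 2 := fun i _ => by positivity
  have hsum : ∑ i, ‖v i‖ ^ 2 = 0 :=
    le_antisymm (nonpos_of_mul_nonpos_right h1 hA) (Finset.sum_nonneg hnn)
  refine hv (funext fun i => ?_)
  simpa using (Finset.sum_eq_zero_iff_of_nonneg hnn).mp hsum i (Finset.mem_univ i)

/-- If the quadratic form of an invertible Hermitian matrix takes values in
`[0, B * ‖x‖ ^ 2]`, then the diagonal entries of its inverse are at least `1 / B`. -/
lemma one_div_le_inv_diag_re {n : Type*} [Fintype n] [DecidableEq n] {M : Matrix n n ℂ} {B : ℝ}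
    (hB : 0 < B) (hM : M.IsHermitian) (hdet : IsUnit M.det)
    (hnonneg : ∀ x : n → ℂ, 0 ≤ (star x ⬝ᵥ M *ᵥ x).re)
    (hle : ∀ x : n → ℂ, (star x ⬝ᵥ M *ᵥ x).re ≤ B * ∑ i, ‖x i‖ ^ 2) (k : n) :
    1 / B ≤ (M⁻¹ k k).re := by
  set e : n → ℂ := Pi.single k 1 with he
  set x : n → ℂ := M⁻¹ *ᵥ e with hx
  have hMx : M *ᵥ x = e := by
    rw [hx, mulVec_mulVec, mul_nonsing_inv _ hdet, one_mulVec]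
  have hxk : x k = M⁻¹ k k := by simp [hx, he]
  have hse : star e = e := by
    ext i
    by_cases hi : i = k <;> simp [he, hi]
  have hxMe : star x ⬝ᵥ M *ᵥ e = 1 := by
    rw [dotProduct_mulVec, ← hM.eq, ← star_mulVec, hMx, hse]
    simp [he]
  have hxx : (star x ⬝ᵥ e).re = (M⁻¹ k k).re := by simp [he, ← hxk]
  have hee : (star e ⬝ᵥ M *ᵥ e).re ≤ B := by
    refine (hle e).trans (le_of_eq ?_)
    simp [he, Pi.single_apply, apply_ite]
  have hy := hnonneg (x - ((1 / B : ℝ) : ℂ) • e)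
  have hexp : (star (x - ((1 / B : ℝ) : ℂ) • e) ⬝ᵥ M *ᵥ (x - ((1 / B : ℝ) : ℂ) • e)).re
      = (M⁻¹ k k).re - 2 * (1 / B) + (1 / B) ^ 2 * (star e ⬝ᵥ M *ᵥ e).re := by
    have hee1 : star e ⬝ᵥ e = 1 := by rw [hse]; simp [he]
    have hst : star (x - ((1 / B : ℝ) : ℂ) • e) = star x - ((1 / B : ℝ) : ℂ) • star e := by
      rw [star_sub, star_smul]
      congr 2
      exact Complex.conj_ofReal _
    rw [hst, mulVec_sub, mulVec_smul, hMx]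
    simp only [sub_dotProduct, dotProduct_sub, smul_dotProduct, dotProduct_smul, hxMe, hee1,
      smul_eq_mul, Complex.sub_re, Complex.re_ofReal_mul, Complex.one_re, hxx]
    ring
  rw [hexp] at hy
  have h2 : (1 / B) ^ 2 * (star e ⬝ᵥ M *ᵥ e).re ≤ (1 / B) ^ 2 * B := by gcongr
  have h3 : (1 / B) ^ 2 * B = 1 / B := by field_simp
  linarith

/-- The integral over `[a, b]` of a function bounded by `L` times the distance to either endpoint
is at most the area of a triangle. -/
lemma integral_le_of_le_mul_dist_endpoints {h : ℝ → ℝ} {a b L : ℝ} (hab : a ≤ b)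
    (hc : Continuous h) (ha : ∀ t, h t ≤ L * |t - a|) (hb : ∀ t, h t ≤ L * |t - b|) :
    ∫ t in a..b, h t ≤ L * (b - a) ^ 2 / 4 := by
  have hi : ∀ u v : ℝ, IntervalIntegrable h MeasureTheory.volume u v :=
    fun u v => hc.intervalIntegrable u v
  rw [← intervalIntegral.integral_add_adjacent_intervals (hi a ((a + b) / 2)) (hi _ b)]
  have h1 : ∫ t in a..((a + b) / 2), h t ≤ ∫ t in a..((a + b) / 2), L * (t - a) := by
    refine intervalIntegral.integral_mono_on (by linarith) (hi _ _)
      (Continuous.intervalIntegrable (by fun_prop) _ _) fun t ht => ?_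
    have := ha t
    rwa [abs_of_nonneg (sub_nonneg.mpr ht.1)] at this
  have h2 : ∫ t in ((a + b) / 2)..b, h t ≤ ∫ t in ((a + b) / 2)..b, L * (b - t) := by
    refine intervalIntegral.integral_mono_on (by linarith) (hi _ _)
      (Continuous.intervalIntegrable (by fun_prop) _ _) fun t ht => ?_
    have := hb t
    rwa [abs_sub_comm, abs_of_nonneg (sub_nonneg.mpr ht.2)] at this
  have h3 : ∫ t in a..((a + b) / 2), L * (t - a) = L * (b - a) ^ 2 / 8 := by
    rw [intervalIntegral.integral_const_mul, intervalIntegral.integral_sub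
      (Continuous.intervalIntegrable (by fun_prop) _ _)
      (Continuous.intervalIntegrable (by fun_prop) _ _), integral_id,
      intervalIntegral.integral_const, smul_eq_mul]
    ring
  have h4 : ∫ t in ((a + b) / 2)..b, L * (b - t) = L * (b - a) ^ 2 / 8 := by
    rw [intervalIntegral.integral_const_mul, intervalIntegral.integral_sub
      (Continuous.intervalIntegrable (by fun_prop) _ _)
      (Continuous.intervalIntegrable (by fun_prop) _ _), integral_id,
      intervalIntegral.integral_const, smul_eq_mul]
    ring
  linarith

/-- A Lipschitz function vanishing at the points `0, 1 / F, …, 1` has small mean absolute value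
on `[0, 1]`. -/
lemma integral_norm_le_of_lipschitz_of_grid_zero {E : Type*} [NormedAddCommGroup E] {g : ℝ → E}
    {L : ℝ} (hg : Continuous g) (hlip : ∀ s t, ‖g s - g t‖ ≤ L * |s - t|) {F : ℕ} (hF : 1 ≤ F)
    (hzero : ∀ f : ℕ, f ≤ F → g ((f : ℝ) / F) = 0) :
    ∫ t in (0 : ℝ)..1, ‖g t‖ ≤ L / (4 * F) := by
  have hF0 : (0 : ℝ) < F := by exact_mod_cast hF
  have hsum := intervalIntegral.sum_integral_adjacent_intervals (f := fun t => ‖g t‖)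
    (μ := MeasureTheory.volume) (a := fun i : ℕ => (i : ℝ) / F) (n := F)
    fun i _ => hg.norm.intervalIntegrable _ _
  simp only [Nat.cast_zero, zero_div, div_self hF0.ne'] at hsum
  rw [← hsum]
  have hbd : ∀ f : ℕ, f ≤ F → ∀ t, ‖g t‖ ≤ L * |t - (f : ℝ) / F| := fun f hf t => by
    simpa [hzero f hf] using hlip t ((f : ℝ) / F)
  calc ∑ i ∈ Finset.range F, ∫ t in ((i : ℝ) / F)..(((i + 1 : ℕ) : ℝ) / F), ‖g t‖
      ≤ ∑ _i ∈ Finset.range F, L * (1 / F) ^ 2 / 4 := by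
        refine Finset.sum_le_sum fun i hi => ?_
        have hiF := Finset.mem_range.mp hi
        refine (integral_le_of_le_mul_dist_endpoints (by gcongr; omega) hg.norm
          (hbd i hiF.le) (hbd (i + 1) hiF)).trans (le_of_eq ?_)
        push_cast
        ring
    _ = L / (4 * F) := by
        rw [Finset.sum_const, Finset.card_range, nsmul_eq_mul]
        field_simp

/-- **precise form of Lemma 1 of the paper.** Let `Σ : ℝ → ℂ^{p×p}` be a
continuous `1`-periodic Hermitian matrix-valued function whose quadratic form is bounded
between `A‖x‖²` and `B‖x‖²` (`0 < A ≤ B`).  Fix `k, l` and suppose `θ ↦ [Σ(θ)⁻¹]_{k,l}` is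
`L`-Lipschitz.  If the global partial coherence
`Γ := ∫₀¹ |[Σ(θ)⁻¹]_{k,l}| / √(Re[Σ(θ)⁻¹]_{k,k} · Re[Σ(θ)⁻¹]_{l,l}) dθ`
satisfies `Γ > B·L/(4F)` for an integer `F ≥ 1`, then `[Σ(f/F)⁻¹]_{k,l} ≠ 0` for some
`f ∈ {0,…,F−1}`. -/
theorem stmt1 (p : ℕ) (hp : 1 ≤ p) (A B : ℝ) (hA : 0 < A) (hAB : A ≤ B)
    (Sdm : ℝ → Matrix (Fin p) (Fin p) ℂ)
    (hcont : Continuous Sdm)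
    (hper : ∀ θ : ℝ, Sdm (θ + 1) = Sdm θ)
    (hherm : ∀ θ : ℝ, (Sdm θ).IsHermitian)
    (hbound : ∀ (θ : ℝ) (x : Fin p → ℂ),
      A * ∑ i, ‖x i‖ ^ 2 ≤ (star x ⬝ᵥ Sdm θ *ᵥ x).re ∧
        (star x ⬝ᵥ Sdm θ *ᵥ x).re ≤ B * ∑ i, ‖x i‖ ^ 2)
    (k l : Fin p) (L : ℝ) (hL : 0 ≤ L)
    (hlip : ∀ θ θ' : ℝ, ‖(Sdm θ)⁻¹ k l - (Sdm θ')⁻¹ k l‖ ≤ L * |θ - θ'|)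
    (F : ℕ) (hF : 1 ≤ F)
    (hΓ : (∫ θ in (0:ℝ)..1, ‖(Sdm θ)⁻¹ k l‖ /
        Real.sqrt (((Sdm θ)⁻¹ k k).re * ((Sdm θ)⁻¹ l l).re)) > B * L / (4 * F)) :
    ∃ f : ℕ, f < F ∧ (Sdm ((f : ℝ) / F))⁻¹ k l ≠ 0 := by
  by_contra! hne
  have hB : 0 < B := hA.trans_le hAB
  have hF0 : (0 : ℝ) < F := by exact_mod_cast hF
  have hg : Continuous fun θ => (Sdm θ)⁻¹ k l :=
    (LipschitzWith.of_dist_le_mul (K := ⟨L, hL⟩) fun s t => by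
      rw [dist_eq_norm, Real.dist_eq]; exact hlip s t).continuous
  have hdiag : ∀ θ j, 1 / B ≤ ((Sdm θ)⁻¹ j j).re := fun θ j =>
    one_div_le_inv_diag_re hB (hherm θ) (isUnit_det_of_coercive hA fun x => (hbound θ x).1)
      (fun x => le_trans (by positivity) (hbound θ x).1) (fun x => (hbound θ x).2) j
  have hsqrt : ∀ θ, 1 / B ≤ Real.sqrt (((Sdm θ)⁻¹ k k).re * ((Sdm θ)⁻¹ l l).re) := fun θ => by
    refine Real.le_sqrt_of_sq_le ?_
    rw [sq]
    exact mul_le_mul (hdiag θ k) (hdiag θ l) (by positivity)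
      (le_trans (by positivity) (hdiag θ k))
  have hzero : ∀ f : ℕ, f ≤ F → (Sdm ((f : ℝ) / F))⁻¹ k l = 0 := fun f hf => by
    rcases hf.lt_or_eq with h | rfl
    · exact hne f h
    · have h0 := hne 0 hF
      rw [Nat.cast_zero, zero_div, ← hper 0, zero_add] at h0
      rwa [div_self hF0.ne']
  have hle : (∫ θ in (0:ℝ)..1, ‖(Sdm θ)⁻¹ k l‖ /
      Real.sqrt (((Sdm θ)⁻¹ k k).re * ((Sdm θ)⁻¹ l l).re)) ≤
      ∫ θ in (0:ℝ)..1, B * ‖(Sdm θ)⁻¹ k l‖ := by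
    refine (Real.le_norm_self _).trans
      (intervalIntegral.norm_integral_le_of_norm_le zero_le_one
        (Filter.Eventually.of_forall fun θ _ => ?_)
        ((continuous_const.mul hg.norm).intervalIntegrable _ _))
    rw [Real.norm_of_nonneg (by positivity)]
    calc _ ≤ ‖(Sdm θ)⁻¹ k l‖ / (1 / B) := by gcongr; exact hsqrt θ
      _ = B * ‖(Sdm θ)⁻¹ k l‖ := by field_simp
  rw [intervalIntegral.integral_const_mul] at hle
  have hmean := mul_le_mul_of_nonneg_left
    (integral_norm_le_of_lipschitz_of_grid_zero hg hlip hF hzero) hB.le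
  rw [← mul_div_assoc] at hmean
  exact absurd hΓ (not_lt.mpr (hle.trans hmean))
end

section
/- Let p ≥ 2, let S ∈ ℂ^{p×p} be Hermitian positive definite, let T be its positive semidefinite square root, let y ∈ ℂ^p be the first column of T, let X ∈ ℂ^{p×(p−1)} consist of the remaining columns of T, and set β := (XᴴX)⁻¹Xᴴy. Then for every k ∈ {2,…,p}: [S⁻¹]_{k,1} = 0 if and only if β_{k−1} = 0. -/
open Matrix
open scoped ComplexOrder

theorem Matrix.inv_succ_zero_eq {R : Type*} [CommRing R] {n : ℕ}
    (S : Matrix (Fin (n + 1)) (Fin (n + 1)) R) (hS : IsUnit S.det)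
    (hG : IsUnit (S.submatrix Fin.succ Fin.succ).det) (j : Fin n) :
    S⁻¹ j.succ 0 =
      -(S⁻¹ 0 0 * ((S.submatrix Fin.succ Fin.succ)⁻¹ *ᵥ fun i => S i.succ 0) j) := by
  set G := S.submatrix Fin.succ Fin.succ with hGdef
  have key : G *ᵥ (fun i => S⁻¹ i.succ 0) = -(S⁻¹ 0 0 • fun i : Fin n => S i.succ 0) := by
    ext i
    have h : (S * S⁻¹) i.succ 0 = 0 := by
      rw [Matrix.mul_nonsing_inv S hS, Matrix.one_apply_ne (Fin.succ_ne_zero i)]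
    rw [Matrix.mul_apply, Fin.sum_univ_succ] at h
    simp only [Matrix.mulVec, dotProduct, hGdef, Matrix.submatrix_apply, Pi.neg_apply,
      Pi.smul_apply, smul_eq_mul]
    linear_combination h
  have h := congrFun (congrArg (G⁻¹ *ᵥ ·) key) j
  simpa [Matrix.mulVec_mulVec, Matrix.nonsing_inv_mul G hG, Matrix.mulVec_neg,
    Matrix.mulVec_smul] using h

/-- Let `p ≥ 2`, let `S ∈ ℂ^{p×p}` be Hermitian positive definite, let `T` be
its positive semidefinite square root, `y` the first column of `T`, `X` the remaining `p-1`
columns of `T`, and `β := (XᴴX)⁻¹Xᴴy`.  Then for every `k ∈ {2,…,p}` (here `0`-indexed as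
`k : Fin p` with `1 ≤ k`): `[S⁻¹]_{k,1} = 0 ↔ β_{k−1} = 0`. -/
theorem stmt2 (p : ℕ) (hp : 2 ≤ p)
    (S T : Matrix (Fin p) (Fin p) ℂ)
    (hS : S.PosDef)
    (hT : T.PosSemidef)
    (hTS : T * T = S)
    (y : Fin p → ℂ)
    (hy : ∀ i, y i = T i ⟨0, by omega⟩)
    (X : Matrix (Fin p) (Fin (p - 1)) ℂ)
    (hX : ∀ i (j : Fin (p - 1)), X i j = T i ⟨j.1 + 1, by have := j.2; omega⟩)
    (β : Fin (p - 1) → ℂ)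
    (hβ : β = (Xᴴ * X)⁻¹ *ᵥ (Xᴴ *ᵥ y)) :
    ∀ k : Fin p, ∀ hk : 1 ≤ k.1,
      (S⁻¹ k ⟨0, by omega⟩ = 0 ↔ β ⟨k.1 - 1, by have := k.2; omega⟩ = 0) := by
  obtain ⟨n, rfl⟩ : ∃ n, p = n + 1 := ⟨p - 1, by omega⟩
  intro k hk
  obtain ⟨j, rfl⟩ : ∃ j : Fin n, k = j.succ :=
    ⟨k.pred (by rintro rfl; simp at hk), by simp⟩
  have hentry (a b : Fin (n + 1)) : ∑ i, star (T i a) * T i b = S a b := by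
    rw [← hTS, Matrix.mul_apply]
    exact Finset.sum_congr rfl fun i _ => by rw [hT.isHermitian.apply]
  have hgram : Xᴴ * X = S.submatrix Fin.succ Fin.succ := by
    ext a b
    simp only [Matrix.mul_apply, Matrix.conjTranspose_apply, hX]
    exact hentry a.succ b.succ
  have hcross : Xᴴ *ᵥ y = fun i : Fin n => S i.succ 0 := by
    ext a
    simp only [Matrix.mulVec, dotProduct, Matrix.conjTranspose_apply, hX, hy]
    exact hentry a.succ 0
  have hG : (S.submatrix Fin.succ Fin.succ).PosDef := hS.submatrix (Fin.succ_injective n)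
  have hcol := Matrix.inv_succ_zero_eq S hS.det_pos.ne'.isUnit hG.det_pos.ne'.isUnit j
  have hpivot : S⁻¹ 0 0 ≠ 0 := hS.inv.diag_pos.ne'
  rw [hgram, hcross] at hβ
  subst hβ
  change S⁻¹ j.succ 0 = 0 ↔ ((S.submatrix Fin.succ Fin.succ)⁻¹ *ᵥ fun i => S i.succ 0) j = 0
  rw [hcol, neg_eq_zero, mul_eq_zero, or_iff_right hpivot]
end

section
/- Let p ≥ 2, let S ∈ ℂ^{p×p} be Hermitian positive definite, let T be its positive semidefinite square root, let y ∈ ℂ^p be the first column of T, let X ∈ ℂ^{p×(p−1)} consist of the remaining columns of T, and set β := (XᴴX)⁻¹Xᴴy. Then for every k ∈ {2,…,p}, [S⁻¹]_{k,1} = −[S⁻¹]_{1,1} · β_{k−1}. In other words, the off-diagonal part of the first column of S⁻¹ equals −ω·β with ω = [S⁻¹]_{1,1}. -/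
open Matrix
open scoped ComplexOrder

/-- The subdiagonal part of the first column of `S⁻¹`, obtained by solving the lower rows of
`S * S⁻¹ = 1`. -/
theorem inv_apply_succ_zero_of_isUnit_det {R : Type*} [CommRing R] {n : ℕ}
    {S : Matrix (Fin (n + 1)) (Fin (n + 1)) R} (hS : IsUnit S.det)
    (hsub : IsUnit (S.submatrix Fin.succ Fin.succ).det) (j : Fin n) :
    S⁻¹ j.succ 0 =
      -(S⁻¹ 0 0) * ((S.submatrix Fin.succ Fin.succ)⁻¹ *ᵥ fun i => S i.succ 0) j := by
  have hrow : S.submatrix Fin.succ Fin.succ *ᵥ (fun i => S⁻¹ i.succ 0) =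
      -(S⁻¹ 0 0) • fun i => S i.succ 0 := by
    ext i
    have h := congrFun (congrFun (mul_nonsing_inv S hS) i.succ) 0
    rw [mul_apply, Fin.sum_univ_succ, one_apply_ne (Fin.succ_ne_zero i)] at h
    simp only [mulVec, dotProduct, submatrix_apply, Pi.smul_apply, smul_eq_mul]
    linear_combination h
  have h := congrFun (congrArg ((S.submatrix Fin.succ Fin.succ)⁻¹ *ᵥ ·) hrow) j
  simpa [mulVec_mulVec, nonsing_inv_mul _ hsub, mulVec_neg, mulVec_smul] using h

/-- With `S` Hermitian positive definite, `T` its positive semidefinite square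
root, `y` the first column of `T`, `X` the remaining columns, and `β := (XᴴX)⁻¹Xᴴy`, for every
`k ∈ {2,…,p}` (`0`-indexed: `1 ≤ k`): `[S⁻¹]_{k,1} = −[S⁻¹]_{1,1}·β_{k−1}`. -/
theorem stmt3 (p : ℕ) (hp : 2 ≤ p)
    (S T : Matrix (Fin p) (Fin p) ℂ)
    (hS : S.PosDef)
    (hT : T.PosSemidef)
    (hTS : T * T = S)
    (y : Fin p → ℂ)
    (hy : ∀ i, y i = T i ⟨0, by omega⟩)
    (X : Matrix (Fin p) (Fin (p - 1)) ℂ)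
    (hX : ∀ i (j : Fin (p - 1)), X i j = T i ⟨j.1 + 1, by have := j.2; omega⟩)
    (β : Fin (p - 1) → ℂ)
    (hβ : β = (Xᴴ * X)⁻¹ *ᵥ (Xᴴ *ᵥ y)) :
    ∀ k : Fin p, ∀ hk : 1 ≤ k.1,
      S⁻¹ k ⟨0, by omega⟩ =
        -(S⁻¹ ⟨0, by omega⟩ ⟨0, by omega⟩) * β ⟨k.1 - 1, by have := k.2; omega⟩ := by
  obtain ⟨n, rfl⟩ : ∃ n, p = n + 1 := ⟨p - 1, by omega⟩
  change Matrix (Fin (n + 1)) (Fin n) ℂ at X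
  change Fin n → ℂ at β
  have hTT : ∀ i j, S i j = ∑ l, star (T l i) * T l j := fun i j => by
    rw [← hTS, mul_apply]
    exact Finset.sum_congr rfl fun l _ => by rw [hT.1.apply]
  have hXX : Xᴴ * X = S.submatrix Fin.succ Fin.succ := by
    ext i j
    rw [submatrix_apply, hTT, mul_apply]
    refine Finset.sum_congr rfl fun l _ => ?_
    rw [conjTranspose_apply, hX, hX]
    rfl
  have hXy : Xᴴ *ᵥ y = fun i => S i.succ 0 := by
    ext i
    rw [hTT, mulVec, dotProduct]
    refine Finset.sum_congr rfl fun l _ => ?_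
    rw [conjTranspose_apply, hX, hy]
    rfl
  have hsub : (S.submatrix (Fin.succ : Fin n → _) Fin.succ).PosDef :=
    hS.submatrix (Fin.succ_injective n)
  intro k hk
  obtain ⟨j, rfl⟩ : ∃ j : Fin n, k = j.succ :=
    ⟨k.pred (by rintro rfl; simp at hk), by simp⟩
  have h := inv_apply_succ_zero_of_isUnit_det ((isUnit_iff_isUnit_det S).1 hS.isUnit)
    ((isUnit_iff_isUnit_det _).1 hsub.isUnit) j
  rw [← hXX, ← hXy] at h
  rw [hβ]
  exact h
end

section
/- Let p ≥ 2, let S ∈ ℂ^{p×p} be Hermitian positive definite, let T be its positive semidefinite square root, let y ∈ ℂ^p be the first column of T, let X ∈ ℂ^{p×(p−1)} consist of the remaining columns of T, set β := (XᴴX)⁻¹Xᴴy and ε := y − Xβ. Then [S⁻¹]_{1,1} = 1/‖ε‖²; in particular [S⁻¹]_{1,1} is real and strictly positive. -/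
open Matrix
open scoped ComplexOrder

/-- Residuals of least squares are orthogonal to the column span. -/
theorem Matrix.conjTranspose_mulVec_leastSquares_residual {m n : Type*} [Fintype m] [Fintype n]
    [DecidableEq n] {X : Matrix m n ℂ} (hX : Function.Injective X.mulVec) (y : m → ℂ) :
    Xᴴ *ᵥ (y - X *ᵥ ((Xᴴ * X)⁻¹ *ᵥ (Xᴴ *ᵥ y))) = 0 := by
  have hu : IsUnit (Xᴴ * X).det :=
    (Matrix.isUnit_iff_isUnit_det _).1 (Matrix.PosDef.conjTranspose_mul_self X hX).isUnit
  rw [mulVec_sub, mulVec_mulVec, mulVec_mulVec, Matrix.mul_nonsing_inv _ hu, one_mulVec, sub_self]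

/-- For an invertible matrix `T` with first column `y` and remaining columns `X`, the leading entry
of `(Tᴴ * T)⁻¹`, multiplied by the squared norm of the least-squares residual of `y` against `X`,
is `1`. -/
theorem Matrix.sum_sq_norm_residual_mul_inv_zero_zero {n : ℕ} {m : Type*} [Fintype m]
    {T : Matrix m (Fin (n + 1)) ℂ} (hT : Function.Injective T.mulVec)
    {y : m → ℂ} (hy : ∀ i, y i = T i 0) {X : Matrix m (Fin n) ℂ}
    (hX : ∀ i j, X i j = T i j.succ) {ε : m → ℂ}
    (hε : ε = y - X *ᵥ ((Xᴴ * X)⁻¹ *ᵥ (Xᴴ *ᵥ y))) :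
    ((∑ i, ‖ε i‖ ^ 2 : ℝ) : ℂ) * (Tᴴ * T)⁻¹ 0 0 = 1 := by
  have hmul (a : ℂ) (v : Fin n → ℂ) : T *ᵥ (Fin.cons a v) = a • y + X *ᵥ v := by
    ext i
    simp [mulVec, dotProduct, Fin.sum_univ_succ, hy, hX, mul_comm]
  have hXinj : Function.Injective X.mulVec := fun v w hvw => by
    have h : T *ᵥ (Fin.cons 0 v) = T *ᵥ (Fin.cons 0 w) := by
      simpa [hmul] using hvw
    exact (Fin.cons_inj.1 (hT h)).2
  have hort := conjTranspose_mulVec_leastSquares_residual hXinj y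
  set β := (Xᴴ * X)⁻¹ *ᵥ (Xᴴ *ᵥ y)
  rw [← hε] at hort
  have hc : T *ᵥ (Fin.cons 1 (-β)) = ε := by
    rw [hmul, hε, one_smul, mulVec_neg, sub_eq_add_neg]
  have hyε : star y ⬝ᵥ ε = ((∑ i, ‖ε i‖ ^ 2 : ℝ) : ℂ) := by
    have hy' : y = ε + X *ᵥ β := by rw [hε, sub_add_cancel]
    have h0 : star (X *ᵥ β) ⬝ᵥ ε = 0 := by
      rw [star_mulVec, ← dotProduct_mulVec, hort, dotProduct_zero]
    rw [hy', star_add, add_dotProduct, h0, add_zero]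
    simp [dotProduct, ← Complex.conj_mul']
  have hr : (Tᴴ * T) *ᵥ (Fin.cons 1 (-β)) =
      Pi.single 0 ((∑ i, ‖ε i‖ ^ 2 : ℝ) : ℂ) := by
    rw [← mulVec_mulVec, hc, ← hyε]
    ext j
    refine Fin.cases ?_ (fun k => ?_) j
    · simp [mulVec, dotProduct, hy]
    · simpa [mulVec, dotProduct, hX] using congrFun hort k
  have hu : IsUnit (Tᴴ * T).det :=
    (Matrix.isUnit_iff_isUnit_det _).1 (Matrix.PosDef.conjTranspose_mul_self T hT).isUnit
  have h := congrFun (congrArg ((Tᴴ * T)⁻¹ *ᵥ ·) hr) 0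
  simp only [mulVec_mulVec, Matrix.nonsing_inv_mul _ hu, one_mulVec, Fin.cons_zero] at h
  rw [h]
  simp [mul_comm]

/-- With `S` Hermitian positive definite, `T` its positive semidefinite square
root, `y` the first column of `T`, `X` the remaining columns, `β := (XᴴX)⁻¹Xᴴy` and
`ε := y − Xβ`, we have `[S⁻¹]_{1,1} = 1/‖ε‖²`; in particular `[S⁻¹]_{1,1}` is real and strictly
positive. -/
theorem stmt4 (p : ℕ) (hp : 2 ≤ p)
    (S T : Matrix (Fin p) (Fin p) ℂ)
    (hS : S.PosDef)
    (hT : T.PosSemidef)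
    (hTS : T * T = S)
    (y : Fin p → ℂ)
    (hy : ∀ i, y i = T i ⟨0, by omega⟩)
    (X : Matrix (Fin p) (Fin (p - 1)) ℂ)
    (hX : ∀ i (j : Fin (p - 1)), X i j = T i ⟨j.1 + 1, by have := j.2; omega⟩)
    (β : Fin (p - 1) → ℂ)
    (hβ : β = (Xᴴ * X)⁻¹ *ᵥ (Xᴴ *ᵥ y))
    (ε : Fin p → ℂ)
    (hε : ε = y - X *ᵥ β) :
    S⁻¹ ⟨0, by omega⟩ ⟨0, by omega⟩ = ((∑ i, ‖ε i‖ ^ 2 : ℝ)⁻¹ : ℂ) ∧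
      (S⁻¹ ⟨0, by omega⟩ ⟨0, by omega⟩).im = 0 ∧
      0 < (S⁻¹ ⟨0, by omega⟩ ⟨0, by omega⟩).re := by
  obtain ⟨n, rfl⟩ : ∃ n, p = n + 1 := ⟨p - 1, by omega⟩
  have hTT : Tᴴ * T = S := by rw [hT.isHermitian.eq, hTS]
  have hTu : IsUnit T := by
    have h : IsUnit (T * T).det := by
      rw [hTS]
      exact (Matrix.isUnit_iff_isUnit_det _).1 hS.isUnit
    rw [det_mul] at h
    exact (Matrix.isUnit_iff_isUnit_det _).2 (isUnit_of_mul_isUnit_left h)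
  have key := Matrix.sum_sq_norm_residual_mul_inv_zero_zero (n := n)
    (Matrix.mulVec_injective_of_isUnit hTu) hy hX (hβ ▸ hε)
  rw [hTT] at key
  have hinv : S⁻¹ ⟨0, by omega⟩ ⟨0, by omega⟩ = (((∑ i, ‖ε i‖ ^ 2 : ℝ)⁻¹ : ℝ) : ℂ) := by
    rw [Complex.ofReal_inv]
    exact eq_inv_of_mul_eq_one_right key
  have hpos : 0 < ∑ i, ‖ε i‖ ^ 2 := by
    refine lt_of_le_of_ne (by positivity) fun h => ?_
    rw [← h] at key
    simp at key
  refine ⟨by rw [hinv, Complex.ofReal_inv], by rw [hinv, Complex.ofReal_im], ?_⟩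
  rw [hinv, Complex.ofReal_re]
  exact inv_pos.2 hpos
end

section
/- Let N ≥ 1 and p ≥ 1, let x[1],…,x[N] ∈ ℝ^p, and for |m| ≤ N−1 let R̂[m] be the sample autocovariances: R̂[m] := (1/N) Σ_{n=1}^{N−m} x[n+m] x[n]ᵀ for 0 ≤ m ≤ N−1 and R̂[m] := R̂[−m]ᵀ for m < 0. Let W : [0,1] → ℝ be integrable with W(ν) ≥ 0 for all ν, and let w : ℤ → ℝ satisfy w[m] = ∫₀¹ W(ν) e^{2πiνm} dν for all |m| ≤ N−1 (in particular these integrals are real). Then for every θ ∈ ℝ, the Blackman–Tukey estimate Σ̂(θ) := Σ_{m=−(N−1)}^{N−1} w[m] R̂[m] e^{−2πiθm} is a Hermitian positive semidefinite matrix, i.e., for every a ∈ ℂ^p, aᴴ Σ̂(θ) a is real and nonnegative. -/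
open Matrix
open scoped ComplexOrder

theorem sum_lag_eq_sum_ite {M : Type*} [AddCommMonoid M] (N m : ℕ) (g : ℕ → ℕ → M) :
    ∑ n ∈ Finset.Icc 1 (N - m), g (n + m) n =
      ∑ i ∈ Finset.Icc 1 N, ∑ j ∈ Finset.Icc 1 N,
        if (i : ℤ) - j = m then g i j else 0 := by
  rw [Finset.sum_comm, ← Finset.sum_subset
    (Finset.Icc_subset_Icc_right (Nat.sub_le N m) : Finset.Icc 1 (N - m) ⊆ Finset.Icc 1 N)]
  · refine Finset.sum_congr rfl fun j hj ↦ ?_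
    rw [Finset.mem_Icc] at hj
    rw [Finset.sum_eq_single_of_mem (j + m) (Finset.mem_Icc.2 (by omega))]
    · rw [if_pos (by push_cast; ring)]
    · exact fun i _ hi ↦ if_neg (by omega)
  · intro j hj hj'
    rw [Finset.mem_Icc] at hj hj'
    refine Finset.sum_eq_zero fun i hi ↦ if_neg ?_
    rw [Finset.mem_Icc] at hi
    omega

/-- The entrywise integral of a nonnegatively weighted family of positive semidefinite matrices
is positive semidefinite. -/
theorem posSemidef_of_intervalIntegral {ι : Type*} [Fintype ι] {a b : ℝ} (hab : a ≤ b)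
    {A : ℝ → Matrix ι ι ℂ} {B : Matrix ι ι ℂ}
    (hint : ∀ k l, IntervalIntegrable (fun ν ↦ A ν k l) MeasureTheory.volume a b)
    (hB : ∀ k l, B k l = ∫ ν in a..b, A ν k l)
    (hA : ∀ ν ∈ Set.Icc a b, (A ν).PosSemidef) : B.PosSemidef := by
  refine .of_dotProduct_mulVec_nonneg ?_ fun v ↦ ?_
  · ext k l
    rw [conjTranspose_apply, hB, hB, Complex.star_def, ← intervalIntegral.intervalIntegral_conj]
    refine intervalIntegral.integral_congr fun ν hν ↦ ?_
    rw [Set.uIcc_of_le hab] at hν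
    exact (hA ν hν).isHermitian.apply k l
  · have key : star v ⬝ᵥ B *ᵥ v = ∫ ν in a..b, star v ⬝ᵥ A ν *ᵥ v := by
      have hmul : ∀ k, IntervalIntegrable (fun ν ↦ ∑ l, A ν k l * v l)
          MeasureTheory.volume a b := fun k ↦ by
        simpa only [Finset.sum_fn] using
          IntervalIntegrable.sum Finset.univ fun l _ ↦ (hint k l).mul_const (v l)
      simp only [dotProduct, mulVec, hB]
      rw [intervalIntegral.integral_finsetSum fun k _ ↦ (hmul k).const_mul _]
      refine Finset.sum_congr rfl fun k _ ↦ ?_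
      rw [intervalIntegral.integral_const_mul,
        intervalIntegral.integral_finsetSum fun l _ ↦ (hint k l).mul_const _]
      simp only [intervalIntegral.integral_mul_const]
    have hre : ∫ ν in a..b, star v ⬝ᵥ A ν *ᵥ v =
        ∫ ν in a..b, (((star v ⬝ᵥ A ν *ᵥ v).re : ℝ) : ℂ) := by
      refine intervalIntegral.integral_congr fun ν hν ↦ ?_
      rw [Set.uIcc_of_le hab] at hν
      exact Complex.eq_re_of_ofReal_le ((hA ν hν).dotProduct_mulVec_nonneg v)
    rw [key, hre, intervalIntegral.integral_ofReal]
    exact Complex.zero_le_real.2 <| intervalIntegral.integral_nonneg hab fun ν hν ↦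
      (Complex.nonneg_iff.1 ((hA ν hν).dotProduct_mulVec_nonneg v)).1

/-- Summing the biased sample autocovariances against weights on the lags amounts to summing
all products of samples against the weight of their time difference. -/
theorem sum_sampleAutocov_mul {ι : Type*} (N : ℕ) (x : ℕ → ι → ℝ) (R : ℤ → Matrix ι ι ℝ)
    (hR : ∀ m : ℕ, m ≤ N - 1 → ∀ k l,
      R m k l = (N : ℝ)⁻¹ * ∑ n ∈ Finset.Icc 1 (N - m), x (n + m) k * x n l)
    (hRneg : ∀ m : ℤ, -((N : ℤ) - 1) ≤ m → m < 0 → R m = (R (-m))ᵀ)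
    (f : ℤ → ℂ) (k l : ι) :
    ∑ m ∈ Finset.Icc (-((N : ℤ) - 1)) ((N : ℤ) - 1), (R m k l : ℂ) * f m =
      (N : ℂ)⁻¹ * ∑ i ∈ Finset.Icc 1 N, ∑ j ∈ Finset.Icc 1 N,
        (x i k : ℂ) * (x j l : ℂ) * f (i - j) := by
  have hlag : ∀ m ∈ Finset.Icc (-((N : ℤ) - 1)) ((N : ℤ) - 1), R m k l =
      (N : ℝ)⁻¹ * ∑ i ∈ Finset.Icc 1 N, ∑ j ∈ Finset.Icc 1 N,
        if (i : ℤ) - j = m then x i k * x j l else 0 := by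
    intro m hm
    rw [Finset.mem_Icc] at hm
    rcases le_or_gt 0 m with h | h
    · lift m to ℕ using h
      rw [hR m (by omega), sum_lag_eq_sum_ite N m fun i j ↦ x i k * x j l]
    · obtain ⟨n, hn⟩ := Int.eq_ofNat_of_zero_le (neg_nonneg.2 h.le)
      rw [hRneg m hm.1 h, hn, transpose_apply, hR n (by omega),
        sum_lag_eq_sum_ite N n fun i j ↦ x i l * x j k, Finset.sum_comm]
      congr 1
      refine Finset.sum_congr rfl fun i _ ↦ Finset.sum_congr rfl fun j _ ↦ ?_
      rw [mul_comm]
      exact if_congr (by omega) rfl rfl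
  calc _ = ∑ m ∈ Finset.Icc (-((N : ℤ) - 1)) ((N : ℤ) - 1), (N : ℂ)⁻¹ *
        ∑ i ∈ Finset.Icc 1 N, ∑ j ∈ Finset.Icc 1 N,
          if (i : ℤ) - j = m then (x i k : ℂ) * (x j l : ℂ) * f m else 0 := by
        refine Finset.sum_congr rfl fun m hm ↦ ?_
        rw [hlag m hm]
        push_cast [apply_ite Complex.ofReal]
        simp only [mul_assoc, Finset.sum_mul, ite_mul, zero_mul]
    _ = _ := by
        rw [← Finset.mul_sum, Finset.sum_comm]
        congr 1
        refine Finset.sum_congr rfl fun i hi ↦ ?_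
        rw [Finset.sum_comm]
        refine Finset.sum_congr rfl fun j hj ↦ ?_
        rw [Finset.mem_Icc] at hi hj
        rw [Finset.sum_ite_eq, if_pos (Finset.mem_Icc.2 (by omega))]

/-- If the window `w` has a nonnegative discrete-time Fourier transform,
i.e. `w[m] = ∫₀¹ W(ν)e^{2πiνm} dν` with `W ≥ 0` integrable on `[0,1]`, then for every `θ` the
Blackman–Tukey estimate `Σ̂(θ) = Σ_{m=−(N−1)}^{N−1} w[m]R̂[m]e^{−2πiθm}` is Hermitian positive
semidefinite (for every `a ∈ ℂ^p`, `aᴴΣ̂(θ)a` is real and nonnegative). -/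
theorem stmt10 (N p : ℕ) (hN : 1 ≤ N) (hp : 1 ≤ p)
    (x : ℕ → Fin p → ℝ)
    (Rhat : ℤ → Matrix (Fin p) (Fin p) ℝ)
    (hRhat1 : ∀ m : ℕ, m ≤ N - 1 → ∀ k l,
      Rhat m k l = (N : ℝ)⁻¹ * ∑ n ∈ Finset.Icc 1 (N - m), x (n + m) k * x n l)
    (hRhat2 : ∀ m : ℤ, -((N : ℤ) - 1) ≤ m → m < 0 → Rhat m = (Rhat (-m))ᵀ)
    (W : ℝ → ℝ)
    (hWint : IntervalIntegrable W MeasureTheory.volume 0 1)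
    (hWpos : ∀ ν ∈ Set.Icc (0 : ℝ) 1, 0 ≤ W ν)
    (w : ℤ → ℝ)
    (hw : ∀ m : ℤ, |m| ≤ (N : ℤ) - 1 →
      (w m : ℂ) = ∫ ν in (0:ℝ)..1, (W ν : ℂ) * Complex.exp (2 * Real.pi * ν * m * Complex.I))
    (Shat : ℝ → Matrix (Fin p) (Fin p) ℂ)
    (hShat : ∀ (θ : ℝ) (k l : Fin p),
      Shat θ k l = ∑ m ∈ Finset.Icc (-((N : ℤ) - 1)) ((N : ℤ) - 1),
        (w m : ℂ) * (Rhat m k l : ℂ) * Complex.exp (-(2 * Real.pi * θ * m) * Complex.I)) :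
    ∀ θ : ℝ, (Shat θ).PosSemidef := by
  intro θ
  let u : ℝ → Fin p → ℂ := fun ν k ↦ ∑ i ∈ Finset.Icc 1 N,
    (x i k : ℂ) * Complex.exp (2 * Real.pi * (ν - θ) * i * Complex.I)
  let A : ℝ → Matrix (Fin p) (Fin p) ℂ := fun ν ↦
    (W ν * (N : ℝ)⁻¹) • vecMulVec (u ν) (star (u ν))
  have hWc : IntervalIntegrable (fun ν ↦ (W ν : ℂ)) MeasureTheory.volume 0 1 := ⟨hWint.1.ofReal, hWint.2.ofReal⟩
  have hA : ∀ ν k l, A ν k l = ∑ m ∈ Finset.Icc (-((N : ℤ) - 1)) ((N : ℤ) - 1),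
      (W ν : ℂ) * Complex.exp (2 * Real.pi * ν * m * Complex.I) *
        ((Rhat m k l : ℂ) * Complex.exp (-(2 * Real.pi * θ * m) * Complex.I)) := by
    intro ν k l
    have h := sum_sampleAutocov_mul N x Rhat hRhat1 hRhat2
      (fun m ↦ Complex.exp (2 * Real.pi * (ν - θ) * m * Complex.I)) k l
    have hprod : u ν k * star (u ν l) = ∑ i ∈ Finset.Icc 1 N, ∑ j ∈ Finset.Icc 1 N,
        (x i k : ℂ) * (x j l : ℂ) *
          Complex.exp (2 * Real.pi * (ν - θ) * ((i - j : ℤ) : ℂ) * Complex.I) := by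
      simp only [u, star_sum, Finset.sum_mul_sum]
      refine Finset.sum_congr rfl fun i _ ↦ Finset.sum_congr rfl fun j _ ↦ ?_
      rw [star_mul', Complex.star_def, Complex.conj_ofReal, ← Complex.exp_conj,
        mul_mul_mul_comm, ← Complex.exp_add]
      congr 2
      simp only [map_mul, map_sub, map_natCast, map_ofNat, Complex.conj_ofReal, Complex.conj_I]
      push_cast
      ring
    simp only [A, Matrix.smul_apply, vecMulVec_apply, Pi.star_apply, Complex.real_smul]
    rw [hprod]
    push_cast at h ⊢
    rw [mul_assoc, ← h, Finset.mul_sum]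
    refine Finset.sum_congr rfl fun m _ ↦ ?_
    rw [← mul_assoc (W ν : ℂ), mul_mul_mul_comm, ← Complex.exp_add]
    congr 2
    ring
  have hint : ∀ (m : ℤ) (c : ℂ), IntervalIntegrable
      (fun ν : ℝ ↦ (W ν : ℂ) * Complex.exp (2 * Real.pi * ν * m * Complex.I) * c)
      MeasureTheory.volume 0 1 := fun m c ↦
    (hWc.mul_continuousOn (by fun_prop)).mul_const c
  refine posSemidef_of_intervalIntegral (A := A) zero_le_one (fun k l ↦ ?_) (fun k l ↦ ?_)
    fun ν hν ↦ ?_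
  · simp only [hA]
    simpa only [Finset.sum_fn] using IntervalIntegrable.sum _ fun m _ ↦ hint m
      ((Rhat m k l : ℂ) * Complex.exp (-(2 * Real.pi * θ * m) * Complex.I))
  · simp only [hA]
    rw [hShat, intervalIntegral.integral_finsetSum fun m _ ↦ hint m _]
    refine Finset.sum_congr rfl fun m hm ↦ ?_
    rw [intervalIntegral.integral_mul_const, ← hw m (abs_le.2 (Finset.mem_Icc.1 hm)), mul_assoc]
  · exact (posSemidef_vecMulVec_self_star (u ν)).smul
      (mul_nonneg (hWpos ν hν) (inv_nonneg.2 N.cast_nonneg))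
end

section
/- Let g : ℝ → ℂ be 1-periodic and Lipschitz with constant L ≥ 0, let F ≥ 1 be an integer, and suppose g(f/F) = 0 for every f ∈ {0,1,…,F−1}. Then ∫₀¹ |g(θ)| dθ ≤ L/(4F). -/
/-- A function which is `L`-Lipschitz and vanishes at both ends of `[a, b]` has `L¹` norm at most
`L (b - a)² / 4` there. -/
theorem integral_norm_le_of_lipschitz_of_eq_zero {E : Type*} [NormedAddCommGroup E]
    {g : ℝ → E} {L a b : ℝ} (hcont : Continuous g)
    (hlip : ∀ x y : ℝ, ‖g x - g y‖ ≤ L * |x - y|) (hab : a ≤ b) (ha : g a = 0) (hb : g b = 0) :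
    ∫ x in a..b, ‖g x‖ ≤ L * (b - a) ^ 2 / 4 := by
  have hint (c d : ℝ) : IntervalIntegrable (fun x => ‖g x‖) MeasureTheory.volume c d :=
    hcont.norm.intervalIntegrable c d
  have hleft : ∫ x in a..(a + b) / 2, ‖g x‖ ≤ ∫ x in a..(a + b) / 2, L * (x - a) := by
    refine intervalIntegral.integral_mono_on (by linarith) (hint _ _)
      (Continuous.intervalIntegrable (by fun_prop) _ _) fun x hx => ?_
    simpa [ha, abs_of_nonneg (sub_nonneg.2 hx.1)] using hlip x a
  have hright : ∫ x in (a + b) / 2..b, ‖g x‖ ≤ ∫ x in (a + b) / 2..b, L * (b - x) := by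
    refine intervalIntegral.integral_mono_on (by linarith) (hint _ _)
      (Continuous.intervalIntegrable (by fun_prop) _ _) fun x hx => ?_
    simpa [hb, abs_sub_comm x b, abs_of_nonneg (sub_nonneg.2 hx.2)] using hlip x b
  calc ∫ x in a..b, ‖g x‖
      = (∫ x in a..(a + b) / 2, ‖g x‖) + ∫ x in (a + b) / 2..b, ‖g x‖ :=
        (intervalIntegral.integral_add_adjacent_intervals (hint _ _) (hint _ _)).symm
    _ ≤ (∫ x in a..(a + b) / 2, L * (x - a)) + ∫ x in (a + b) / 2..b, L * (b - x) :=
        add_le_add hleft hright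
    _ = L * (b - a) ^ 2 / 4 := by
        simp only [intervalIntegral.integral_const_mul,
          intervalIntegral.integral_comp_sub_right (fun x => x),
          intervalIntegral.integral_comp_sub_left (fun x => x), integral_id]
        ring

/-- If `g : ℝ → ℂ` is `1`-periodic, `L`-Lipschitz, and vanishes at the `F`
uniformly spaced points `f/F`, `f ∈ {0,…,F−1}`, then `∫₀¹ |g(θ)| dθ ≤ L/(4F)`. -/
theorem stmt11 (g : ℝ → ℂ) (L : ℝ) (hL : 0 ≤ L)
    (hper : ∀ θ : ℝ, g (θ + 1) = g θ)
    (hlip : ∀ θ θ' : ℝ, ‖g θ - g θ'‖ ≤ L * |θ - θ'|)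
    (F : ℕ) (hF : 1 ≤ F)
    (hzero : ∀ f : ℕ, f < F → g ((f : ℝ) / F) = 0) :
    ∫ θ in (0:ℝ)..1, ‖g θ‖ ≤ L / (4 * F) := by
  have hcont : Continuous g :=
    (LipschitzWith.of_dist_le_mul (K := L.toNNReal) fun x y => by
      simpa [dist_eq_norm, hL] using hlip x y).continuous
  have hF0 : (F : ℝ) ≠ 0 := by positivity
  have hgrid (k : ℕ) (hk : k ≤ F) : g ((k : ℝ) / F) = 0 := by
    rcases hk.lt_or_eq with hk | rfl
    · exact hzero k hk
    · have h0 := hzero 0 hF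
      have h1 := hper 0
      simp only [Nat.cast_zero, zero_div, zero_add] at h0 h1
      rw [div_self hF0, h1, h0]
  have hsum := intervalIntegral.sum_integral_adjacent_intervals (μ := MeasureTheory.volume)
    (a := fun k : ℕ => (k : ℝ) / F) (n := F) (f := fun θ => ‖g θ‖)
    fun k _ => hcont.norm.intervalIntegrable _ _
  simp only [Nat.cast_zero, zero_div, div_self hF0] at hsum
  calc ∫ θ in (0:ℝ)..1, ‖g θ‖
      = ∑ k ∈ Finset.range F, ∫ θ in (k : ℝ) / F..((k + 1 : ℕ) : ℝ) / F, ‖g θ‖ := hsum.symm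
    _ ≤ ∑ k ∈ Finset.range F, L * (((k + 1 : ℕ) : ℝ) / F - (k : ℝ) / F) ^ 2 / 4 := by
        refine Finset.sum_le_sum fun k hk => ?_
        have hk := Finset.mem_range.1 hk
        exact integral_norm_le_of_lipschitz_of_eq_zero hcont hlip (by gcongr; omega)
          (hgrid k hk.le) (hgrid (k + 1) hk)
    _ = ∑ _k ∈ Finset.range F, L * (1 / F) ^ 2 / 4 := by
        refine Finset.sum_congr rfl fun k _ => ?_
        rw [← sub_div, Nat.cast_succ, add_sub_cancel_left]
    _ = L / (4 * F) := by
        rw [Finset.sum_const, Finset.card_range, nsmul_eq_mul]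
        field_simp
end

section
/- Let (Ω, P) be a probability space, N ≥ 1, p ≥ 1, and let x[1],…,x[N] : Ω → ℝ^p be random vectors. Let R : ℤ → ℝ^{p×p} with (‖R[m]‖_∞)_{m∈ℤ} summable, where ‖M‖_∞ := max_{k,l}|M_{k,l}|, and suppose that for every m with |m| ≤ N−1, every valid n, and every k, l, E[x[n+m]_k x[n]_l] = [R[m]]_{k,l} (with R[−m] = R[m]ᵀ). Let w : ℤ → ℝ be a window function, define the Blackman–Tukey estimate Σ̂(θ) := Σ_{m=−(N−1)}^{N−1} w[m] R̂[m] e^{−2πiθm} with R̂[m] := (1/N)Σ_{n=1}^{N−m} x[n+m]x[n]ᵀ for m ≥ 0 and R̂[m] := R̂[−m]ᵀ for m < 0, and define the spectral density Σ(θ) := Σ_{m∈ℤ} R[m] e^{−2πiθm}. Define h₁[m] := |1 − w[m](1 − |m|/N)| for |m| ≤ N−1 and h₁[m] := 1 for |m| ≥ N. Then for every θ ∈ ℝ and every k, l ∈ {1,…,p}, |E[[Σ̂(θ)]_{k,l}] − [Σ(θ)]_{k,l}| ≤ Σ_{m∈ℤ} h₁[m] · ‖R[m]‖_∞ (the right-hand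 side being the ACF moment μ^{(h₁)}, assumed finite). -/
open Matrix MeasureTheory

/-- The entrywise sup-norm `‖M‖_∞ = max_{k,l} |M_{k,l}|` of a real matrix. -/
noncomputable def entrySupR {p : ℕ} (M : Matrix (Fin p) (Fin p) ℝ) : ℝ :=
  ⨆ k, ⨆ l, |M k l|

theorem abs_apply_le_entrySupR {p : ℕ} (M : Matrix (Fin p) (Fin p) ℝ) (k l : Fin p) :
    |M k l| ≤ entrySupR M :=
  (le_ciSup (f := fun l => |M k l|) (Set.finite_range _).bddAbove l).trans
    (le_ciSup (f := fun k => ⨆ l, |M k l|) (Set.finite_range _).bddAbove k)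

/-- The biased sample autocovariance `N⁻¹ ∑_{n=1}^{N-m} y n` of summands with common mean `r` is
integrable with mean `(1 - m / N) * r`. -/
theorem integrable_and_integral_biased_average {Ω : Type*} [MeasureSpace Ω] {N m : ℕ}
    (hm : m < N) {y : ℕ → Ω → ℝ} {r : ℝ}
    (hy : ∀ n, 1 ≤ n → n ≤ N - m → Integrable (y n) ∧ ∫ ω, y n ω = r) :
    Integrable (fun ω => (N : ℝ)⁻¹ * ∑ n ∈ Finset.Icc 1 (N - m), y n ω) ∧
      ∫ ω, (N : ℝ)⁻¹ * ∑ n ∈ Finset.Icc 1 (N - m), y n ω = (1 - m / N) * r := by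
  have hint : ∀ n ∈ Finset.Icc 1 (N - m), Integrable (y n) := fun n hn =>
    (hy n (Finset.mem_Icc.1 hn).1 (Finset.mem_Icc.1 hn).2).1
  refine ⟨(integrable_finsetSum _ hint).const_mul _, ?_⟩
  rw [integral_const_mul, integral_finsetSum _ hint, Finset.sum_congr rfl fun n hn =>
    (hy n (Finset.mem_Icc.1 hn).1 (Finset.mem_Icc.1 hn).2).2]
  have hN : (N : ℝ) ≠ 0 := by exact_mod_cast (Nat.zero_lt_of_lt hm).ne'
  simp only [Finset.sum_const, Nat.card_Icc, Nat.add_sub_cancel, nsmul_eq_mul,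
    Nat.cast_sub hm.le]
  field_simp

/-- The distance between a truncated, weighted sum and the full series, with unimodular factors
`e`. -/
theorem norm_sum_sub_tsum_le {ι : Type*} [DecidableEq ι] (s : Finset ι) (c r b h : ι → ℝ)
    (e : ι → ℂ) (he : ∀ i, ‖e i‖ = 1) (hrb : ∀ i, |r i| ≤ b i) (hb : Summable b)
    (hs : ∀ i ∈ s, h i = |1 - c i|) (hs' : ∀ i ∉ s, h i = 1)
    (hh : Summable fun i => h i * b i) :
    ‖∑ i ∈ s, (c i : ℂ) * (r i : ℂ) * e i - ∑' i, (r i : ℂ) * e i‖ ≤ ∑' i, h i * b i := by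
  have hsum : Summable fun i => (r i : ℂ) * e i :=
    Summable.of_norm_bounded hb fun i => by simpa [he i] using hrb i
  have hfin : HasSum (fun i => if i ∈ s then (c i : ℂ) * (r i : ℂ) * e i else 0)
      (∑ i ∈ s, (c i : ℂ) * (r i : ℂ) * e i) := by
    have := hasSum_sum_of_ne_finset_zero (s := s) (L := .unconditional ι)
      (f := fun i => if i ∈ s then (c i : ℂ) * (r i : ℂ) * e i else 0)
      (fun i hi => if_neg hi)
    rwa [Finset.sum_congr rfl fun i hi => if_pos hi] at this
  rw [← (hfin.sub hsum.hasSum).tsum_eq]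
  refine tsum_of_norm_bounded hh.hasSum fun i => ?_
  by_cases hi : i ∈ s
  · have : (c i : ℂ) * (r i : ℂ) * e i - (r i : ℂ) * e i
        = ((c i - 1 : ℝ) : ℂ) * (r i : ℂ) * e i := by
      push_cast
      ring
    rw [if_pos hi, this, norm_mul, norm_mul, he, mul_one, Complex.norm_real, Complex.norm_real,
      Real.norm_eq_abs, Real.norm_eq_abs, hs i hi, abs_sub_comm]
    exact mul_le_mul_of_nonneg_left (hrb i) (abs_nonneg _)
  · simpa [hi, hs' i hi, he i] using hrb i

/-- Deterministic bias bound for the Blackman–Tukey spectral estimator: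
for a second-order stationary process with summable ACF `R`, window `w`, and weight
`h₁[m] = |1 − w[m](1 − |m|/N)|` for `|m| ≤ N−1`, `h₁[m] = 1` for `|m| ≥ N`, one has
`|E[[Σ̂(θ)]_{k,l}] − [Σ(θ)]_{k,l}| ≤ Σ_m h₁[m]·‖R[m]‖_∞ = μ^{(h₁)}`. -/
theorem stmt16 (Ω : Type*) [MeasureSpace Ω]
    [IsProbabilityMeasure (volume : Measure Ω)]
    (N p : ℕ) (hN : 1 ≤ N) (hp : 1 ≤ p)
    (x : ℕ → Ω → Fin p → ℝ)
    (R : ℤ → Matrix (Fin p) (Fin p) ℝ)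
    (hRsym : ∀ m : ℤ, R (-m) = (R m)ᵀ)
    (hRsum : Summable fun m : ℤ => entrySupR (R m))
    (hexp : ∀ m : ℕ, m ≤ N - 1 → ∀ n : ℕ, 1 ≤ n → n ≤ N - m → ∀ k l : Fin p,
      Integrable (fun ω => x (n + m) ω k * x n ω l) ∧
        ∫ ω, x (n + m) ω k * x n ω l = R m k l)
    (w : ℤ → ℝ)
    (Rhat : ℤ → Ω → Matrix (Fin p) (Fin p) ℝ)
    (hRhat1 : ∀ m : ℕ, m ≤ N - 1 → ∀ (ω : Ω) (k l : Fin p),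
      Rhat m ω k l = (N : ℝ)⁻¹ * ∑ n ∈ Finset.Icc 1 (N - m), x (n + m) ω k * x n ω l)
    (hRhat2 : ∀ m : ℤ, m < 0 → ∀ ω : Ω, Rhat m ω = (Rhat (-m) ω)ᵀ)
    (Shat : ℝ → Ω → Matrix (Fin p) (Fin p) ℂ)
    (hShat : ∀ (θ : ℝ) (ω : Ω) (k l : Fin p),
      Shat θ ω k l = ∑ m ∈ Finset.Icc (-((N : ℤ) - 1)) ((N : ℤ) - 1),
        (w m : ℂ) * (Rhat m ω k l : ℂ) * Complex.exp (-(2 * Real.pi * θ * m) * Complex.I))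
    (Sdm : ℝ → Matrix (Fin p) (Fin p) ℂ)
    (hSdm : ∀ (θ : ℝ) (k l : Fin p),
      Sdm θ k l = ∑' m : ℤ, (R m k l : ℂ) * Complex.exp (-(2 * Real.pi * θ * m) * Complex.I))
    (h1 : ℤ → ℝ)
    (hh1a : ∀ m : ℤ, |m| ≤ (N : ℤ) - 1 → h1 m = |1 - w m * (1 - |(m : ℝ)| / N)|)
    (hh1b : ∀ m : ℤ, (N : ℤ) ≤ |m| → h1 m = 1)
    (hμsum : Summable fun m : ℤ => h1 m * entrySupR (R m)) :
    ∀ (θ : ℝ) (k l : Fin p),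
      ‖(∫ ω, Shat θ ω k l) - Sdm θ k l‖ ≤ ∑' m : ℤ, h1 m * entrySupR (R m) := by
  intro θ k l
  have hR : ∀ m : ℤ, |m| ≤ (N : ℤ) - 1 → ∀ k l : Fin p,
      Integrable (fun ω => Rhat m ω k l) ∧
        ∫ ω, Rhat m ω k l = (1 - |(m : ℝ)| / N) * R m k l := by
    have hnat : ∀ m : ℕ, m ≤ N - 1 → ∀ k l : Fin p,
        Integrable (fun ω => Rhat m ω k l) ∧
          ∫ ω, Rhat m ω k l = (1 - (m : ℝ) / N) * R m k l := by
      intro m hm k l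
      simp only [hRhat1 m hm]
      exact integrable_and_integral_biased_average (by omega)
        fun n hn hn' => hexp m hm n hn hn' k l
    intro m hm k l
    obtain ⟨n, rfl | rfl⟩ := m.eq_nat_or_neg
    · simpa using hnat n (by simp at hm; omega) k l
    · rcases Nat.eq_zero_or_pos n with rfl | hn
      · simpa using hnat 0 (by omega) k l
      · simpa [hRhat2 (-(n : ℤ)) (by omega), hRsym] using hnat n (by simp at hm; omega) l k
  have hmem : ∀ m : ℤ, m ∈ Finset.Icc (-((N : ℤ) - 1)) ((N : ℤ) - 1) ↔ |m| ≤ (N : ℤ) - 1 :=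
    fun m => by rw [Finset.mem_Icc, abs_le]
  have hmean : ∫ ω, Shat θ ω k l = ∑ m ∈ Finset.Icc (-((N : ℤ) - 1)) ((N : ℤ) - 1),
      ((w m * (1 - |(m : ℝ)| / N) : ℝ) : ℂ) * (R m k l : ℂ) *
        Complex.exp (-(2 * Real.pi * θ * m) * Complex.I) := by
    simp only [hShat]
    rw [integral_finsetSum _ fun m hm =>
      (((hR m ((hmem m).1 hm) k l).1.ofReal).const_mul _).mul_const _]
    refine Finset.sum_congr rfl fun m hm => ?_
    rw [integral_mul_const, integral_const_mul, integral_complex_ofReal,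
      (hR m ((hmem m).1 hm) k l).2]
    push_cast
    ring
  rw [hmean, hSdm]
  refine norm_sum_sub_tsum_le _ (fun m => w m * (1 - |(m : ℝ)| / N)) (fun m => R m k l)
    (fun m => entrySupR (R m)) h1
    (fun m => Complex.exp (-(2 * Real.pi * θ * m) * Complex.I)) (fun m => ?_)
    (fun m => abs_apply_le_entrySupR _ k l) hRsum (fun m hm => hh1a m ((hmem m).1 hm))
    (fun m hm => hh1b m ?_) hμsum
  · exact_mod_cast Complex.norm_exp_ofReal_mul_I (-(2 * Real.pi * θ * m))
  · rw [hmem] at hm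
    omega
end
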